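/- arXiv:2209.10467 — 2 statements merged into one kernel-verified Lean document; each statement's English description precedes it below -/
import Mathlib

section
/- Let 0 < c < 1 and take the horocycle data γ(r) = ((2+r²)/2, r, r²/2) with N(r) = (−r²/2, −r, (2−r²)/2) (curvature κ ≡ 1), and γ̃(s) = ((2+s²)/2, s, s²/2) with Ñ(s) = (s²/2, s, (−2+s²)/2) (curvature κ̃ ≡ −1). Let Φ and 𝒩 be the associated immersion and unit normal of M^c_{1,−1}. Then for all (t,r,s): ∂𝒩/∂t = √(c(1−c))·(p, −q), ∂𝒩/∂r = −√(1−c)·∂Φ/∂r, and ∂𝒩/∂s = −√c·∂Φ/∂s; that is, the hypersurface M^c_{1,−1} has constant principal curvatures 0, √(1−c) and √c. -/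
noncomputable section

/-- Vectors in ℝ³ (written as triples). -/
abbrev V3 : Type := ℝ × ℝ × ℝ

/-- The Minkowski bilinear form ⟪x,y⟫ = −x₁y₁ + x₂y₂ + x₃y₃ on ℝ³₁. -/
def mink (x y : V3) : ℝ := -(x.1 * y.1) + x.2.1 * y.2.1 + x.2.2 * y.2.2

/-- The Lorentzian cross product a ⊠ b = (a₃b₂ − a₂b₃, a₃b₁ − a₁b₃, a₁b₂ − a₂b₁). -/
def lcross (a b : V3) : V3 :=
  (a.2.2 * b.2.1 - a.2.1 * b.2.2, a.2.2 * b.1 - a.1 * b.2.2, a.1 * b.2.1 - a.2.1 * b.1)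

/-- The hyperbolic plane H² = {x ∈ ℝ³₁ : ⟪x,x⟫ = −1, x₁ > 0}. -/
def H2 : Set V3 := {x | mink x x = -1 ∧ 0 < x.1}

/-- The product metric ⟨(x,y),(x',y')⟩ = ⟪x,x'⟫ + ⟪y,y'⟫ on ℝ³ × ℝ³. -/
def pInner (v w : V3 × V3) : ℝ := mink v.1 w.1 + mink v.2 w.2

/-- The product structure P(v₁,v₂) = (v₁,−v₂). -/
def Pstr (v : V3 × V3) : V3 × V3 := (v.1, -v.2)

theorem hasDerivAt_sinh_smul_add_cosh_smul {E : Type*} [NormedAddCommGroup E] [NormedSpace ℝ E]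
    (a t : ℝ) (x y : E) :
    HasDerivAt (fun t => Real.sinh (a * t) • x + Real.cosh (a * t) • y)
      (a • (Real.cosh (a * t) • x + Real.sinh (a * t) • y)) t := by
  have h : HasDerivAt (fun t => a * t) a t := by
    simpa using (hasDerivAt_id t).const_mul a
  refine ((h.sinh.smul_const x).add (h.cosh.smul_const y)).congr_deriv ?_
  module

/-- The horocycle `((2 + r²) / 2, r, r² / 2)` has velocity `(r, 1, r)`. -/
theorem hasDerivAt_horocycle (r : ℝ) :
    HasDerivAt (fun r : ℝ => (((2 + r ^ 2) / 2, r, r ^ 2 / 2) : V3)) (r, 1, r) r := by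
  have h : HasDerivAt (fun r : ℝ => r ^ 2 / 2) r r := by
    simpa using (hasDerivAt_pow 2 r).div_const 2
  have h' : HasDerivAt (fun r : ℝ => (2 + r ^ 2) / 2) r r := by
    simpa using ((hasDerivAt_pow 2 r).const_add 2).div_const 2
  exact h'.prodMk ((hasDerivAt_id r).prodMk h)

/-- For the horocycle data γ(r) = ((2+r²)/2, r, r²/2),
N(r) = (−r²/2, −r, (2−r²)/2), γ̃(s) = ((2+s²)/2, s, s²/2), Ñ(s) = (s²/2, s, (−2+s²)/2),
the hypersurface M^c_{1,−1} satisfies ∂𝒩/∂t = √(c(1−c))·(p,−q),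
∂𝒩/∂r = −√(1−c)·∂Φ/∂r and ∂𝒩/∂s = −√c·∂Φ/∂s; i.e. it has constant principal
curvatures 0, √(1−c) and √c. -/
theorem M_one_minus_one_constant_principal_curvatures (c : ℝ) (hc0 : 0 < c) (hc1 : c < 1)
    (γ γt N Nt : ℝ → V3)
    (hγ : ∀ r, γ r = ((2 + r ^ 2) / 2, r, r ^ 2 / 2))
    (hN : ∀ r, N r = (-(r ^ 2) / 2, -r, (2 - r ^ 2) / 2))
    (hγt : ∀ s, γt s = ((2 + s ^ 2) / 2, s, s ^ 2 / 2))
    (hNt : ∀ s, Nt s = (s ^ 2 / 2, s, (-2 + s ^ 2) / 2))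
    (p q : ℝ → ℝ → V3)
    (hp : ∀ t r, p t r =
      Real.cosh (Real.sqrt c * t) • γ r + Real.sinh (Real.sqrt c * t) • N r)
    (hq : ∀ t s, q t s =
      Real.cosh (Real.sqrt (1 - c) * t) • γt s + Real.sinh (Real.sqrt (1 - c) * t) • Nt s)
    (Φ : ℝ → ℝ → ℝ → V3 × V3) (hΦ : ∀ t r s, Φ t r s = (p t r, q t s))
    (𝒩 : ℝ → ℝ → ℝ → V3 × V3)
    (h𝒩 : ∀ t r s, 𝒩 t r s =
      (Real.sqrt (1 - c) •
          (Real.sinh (Real.sqrt c * t) • γ r + Real.cosh (Real.sqrt c * t) • N r),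
       -(Real.sqrt c •
          (Real.sinh (Real.sqrt (1 - c) * t) • γt s +
            Real.cosh (Real.sqrt (1 - c) * t) • Nt s)))) :
    ∀ t r s,
      deriv (fun t' => 𝒩 t' r s) t
        = Real.sqrt (c * (1 - c)) • ((p t r, -(q t s)) : V3 × V3) ∧
      deriv (fun r' => 𝒩 t r' s) r
        = -(Real.sqrt (1 - c)) • deriv (fun r' => Φ t r' s) r ∧
      deriv (fun s' => 𝒩 t r s') s
        = -(Real.sqrt c) • deriv (fun s' => Φ t r s') s := by
  have hγ' : ∀ r, HasDerivAt γ (r, 1, r) r := fun r => by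
    rw [funext hγ]; exact hasDerivAt_horocycle r
  have hγt' : ∀ s, HasDerivAt γt (s, 1, s) s := fun s => by
    rw [funext hγt]; exact hasDerivAt_horocycle s
  have hN' : ∀ r, HasDerivAt N (-(r, 1, r)) r := fun r => by
    have hNγ : N = fun r => (1, 0, 1) - γ r := by
      funext r
      rw [hN, hγ]
      ext <;> simp <;> ring
    rw [hNγ]
    exact (hγ' r).const_sub _
  have hNt' : ∀ s, HasDerivAt Nt (s, 1, s) s := fun s => by
    have hNγ : Nt = fun s => γt s - (1, 0, 1) := by
      funext s
      rw [hNt, hγt]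
      ext <;> simp <;> ring
    rw [hNγ]
    exact (hγt' s).sub_const _
  intro t r s
  simp only [h𝒩, hΦ, hp, hq]
  refine ⟨?_, ?_, ?_⟩
  · have h₁ := (hasDerivAt_sinh_smul_add_cosh_smul √c t (γ r) (N r)).const_smul √(1 - c)
    have h₂ := ((hasDerivAt_sinh_smul_add_cosh_smul √(1 - c) t (γt s) (Nt s)).const_smul √c).neg
    refine (h₁.prodMk h₂).deriv.trans ?_
    rw [Real.sqrt_mul hc0.le]
    refine Prod.ext ?_ ?_ <;> simp only [Prod.smul_fst, Prod.smul_snd] <;> module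
  · have h₁ := (((hγ' r).const_smul (Real.sinh (√c * t))).add
      ((hN' r).const_smul (Real.cosh (√c * t)))).const_smul √(1 - c)
    have h₂ := ((hγ' r).const_smul (Real.cosh (√c * t))).add
      ((hN' r).const_smul (Real.sinh (√c * t)))
    refine (h₁.prodMk (hasDerivAt_const r _)).deriv.trans ?_
    refine Eq.trans ?_ (congrArg _ (h₂.prodMk (hasDerivAt_const r _)).deriv.symm)
    refine Prod.ext ?_ ?_ <;> simp only [Prod.smul_fst, Prod.smul_snd] <;> module
  · have h₁ := ((((hγt' s).const_smul (Real.sinh (√(1 - c) * t))).add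
      ((hNt' s).const_smul (Real.cosh (√(1 - c) * t)))).const_smul √c).neg
    have h₂ := ((hγt' s).const_smul (Real.cosh (√(1 - c) * t))).add
      ((hNt' s).const_smul (Real.sinh (√(1 - c) * t)))
    refine ((hasDerivAt_const s _).prodMk h₁).deriv.trans ?_
    refine Eq.trans ?_ (congrArg _ ((hasDerivAt_const s _).prodMk h₂).deriv.symm)
    refine Prod.ext ?_ ?_ <;> simp only [Prod.smul_fst, Prod.smul_snd] <;> module
end
end

section
/- Let τ < −1 and p, q ∈ H² with ⟪p,q⟫ = τ, and define A(v₁,v₂) = (1/√(2(τ²−1)))·[−(v₂,v₁) − τ(v₁,v₂) − ⟪p,v₂⟫·(p,−q)] for (v₁,v₂) ∈ ℝ³ × ℝ³. Then A(p ⊠ q, −(q ⊠ p)) = √((τ+1)/(2(τ−1)))·(p ⊠ q, −(q ⊠ p)) and A(q + τp, −(p + τq)) = 0; that is, J₂N is a principal curvature vector with principal curvature √((τ+1)/(2(τ−1))), and the tangential part V = PN of the product structure applied to the normal satisfies AV = 0. -/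
noncomputable section

theorem mink_add_right (x y z : V3) : mink x (y + z) = mink x y + mink x z := by
  simp only [mink, Prod.fst_add, Prod.snd_add]
  ring

theorem mink_smul_right (c : ℝ) (x y : V3) : mink x (c • y) = c * mink x y := by
  simp only [mink, Prod.smul_fst, Prod.smul_snd, smul_eq_mul]
  ring

theorem mink_neg_right (x y : V3) : mink x (-y) = -mink x y := by
  simp only [mink, Prod.fst_neg, Prod.snd_neg]
  ring

theorem mink_lcross_self_left (a b : V3) : mink a (lcross a b) = 0 := by
  simp only [mink, lcross]
  ring

theorem neg_lcross (a b : V3) : -lcross b a = lcross a b := by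
  ext <;> simp [lcross] <;> ring

/-- The two expressions for the principal curvature in the direction of `J₂N` agree. -/
theorem inv_sqrt_mul_neg_one_sub {τ : ℝ} (hτ : τ < -1) :
    (Real.sqrt (2 * (τ ^ 2 - 1)))⁻¹ * (-1 - τ) = Real.sqrt ((τ + 1) / (2 * (τ - 1))) := by
  have h : (τ + 1) / (2 * (τ - 1)) = (-1 - τ) ^ 2 / (2 * (τ ^ 2 - 1)) := by
    have h₁ : τ - 1 ≠ 0 := by linarith
    have h₂ : τ ^ 2 - 1 ≠ 0 := by nlinarith
    field_simp
    ring
  rw [h, Real.sqrt_div (sq_nonneg _), Real.sqrt_sq (by linarith), inv_mul_eq_div]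

/-- For τ < −1, (p,q) ∈ M_τ and the shape operator
A(v₁,v₂) = [−(v₂,v₁) − τ(v₁,v₂) − ⟪p,v₂⟫(p,−q)]/√(2(τ²−1)), the vector
(p ⊠ q, −(q ⊠ p)) (proportional to J₂N) is a principal curvature vector with
principal curvature √((τ+1)/(2(τ−1))), and (q + τp, −(p + τq)) (proportional to
V = PN) satisfies AV = 0. -/
theorem J2N_and_V_principal_curvature_vectors_of_M_tau (τ : ℝ) (hτ : τ < -1) (p q : V3)
    (hp : p ∈ H2) (hq : q ∈ H2) (hpq : mink p q = τ)
    (A : V3 × V3 → V3 × V3)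
    (hA : ∀ v : V3 × V3, A v = (Real.sqrt (2 * (τ ^ 2 - 1)))⁻¹ •
      (-((v.2, v.1) : V3 × V3) - τ • v - mink p v.2 • ((p, -q) : V3 × V3))) :
    A (lcross p q, -(lcross q p))
      = Real.sqrt ((τ + 1) / (2 * (τ - 1))) • ((lcross p q, -(lcross q p)) : V3 × V3) ∧
    A (q + τ • p, -(p + τ • q)) = 0 := by
  constructor
  · rw [neg_lcross, hA, mink_lcross_self_left, zero_smul, sub_zero, ← inv_sqrt_mul_neg_one_sub hτ,
      mul_smul, sub_smul, neg_smul, one_smul]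
  · have h : mink p (-(p + τ • q)) = 1 - τ ^ 2 := by
      rw [mink_neg_right, mink_add_right, mink_smul_right, hp.1, hpq]
      ring
    rw [hA, h, smul_eq_zero]
    right
    ext <;> simp <;> ring
end
end
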